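/- Let Ω ⊂⊂ ℂⁿ be a bounded pseudoconvex domain with C^k (k ≥ 3)-smooth boundary, ρ a defining function of Ω, and α = α_ρ the D'Angelo 1-form of ρ. Then for every smooth (1,0) tangent vector field L on ∂Ω, α(L̄) = ∂ρ([L_n, L̄]) = 2 Levi_ρ(N, L)/‖∇ρ‖ on ∂Ω, where N := (Σ_j |∂ρ/∂z_j|²)^{-1/2} Σ_j (∂ρ/∂z̄_j) ∂/∂z_j, L_n := (Σ_j |∂ρ/∂z_j|²)^{-1} Σ_j (∂ρ/∂z̄_j) ∂/∂z_j, and ∇ρ is the real gradient of ρ. -/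

import Mathlib

open Complex
open scoped ComplexOrder

noncomputable section

/-- Points of ℂⁿ. -/
abbrev Pt (n : ℕ) := Fin n → ℂ

/-- Wirtinger derivative ∂f/∂z_j at z (junk value if f is not differentiable). -/
def dZ (n : ℕ) (f : Pt n → ℂ) (j : Fin n) (z : Pt n) : ℂ :=
  (1 / 2 : ℂ) * (fderiv ℝ f z (Pi.single j 1) - Complex.I * fderiv ℝ f z (Pi.single j Complex.I))

/-- Wirtinger derivative ∂f/∂z̄_j at z. -/
def dZb (n : ℕ) (f : Pt n → ℂ) (j : Fin n) (z : Pt n) : ℂ :=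
  (1 / 2 : ℂ) * (fderiv ℝ f z (Pi.single j 1) + Complex.I * fderiv ℝ f z (Pi.single j Complex.I))

/-- Complexification of a real-valued function. -/
def cR (n : ℕ) (ρ : Pt n → ℝ) : Pt n → ℂ := fun z => (ρ z : ℂ)

/-- Levi form of ρ at z: Levi_ρ(X,Y) = Σ_{j,k} ∂²ρ/∂z_j∂z̄_k X_j conj(Y_k), where X, Y are
(1,0)-vectors given by their coefficient tuples. -/
def levi (n : ℕ) (ρ : Pt n → ℝ) (z : Pt n) (X Y : Fin n → ℂ) : ℂ :=
  ∑ j, ∑ k, dZ n (fun w => dZb n (cR n ρ) k w) j z * X j * (starRingEnd ℂ) (Y k)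

/-- Holomorphic tangent space T^{1,0}_p(∂Ω) (for boundary points p), described via a defining
function: (1,0)-vectors X with Σ_j X_j ∂ρ/∂z_j(p) = 0. -/
def T10 (n : ℕ) (ρ : Pt n → ℝ) (p : Pt n) : Set (Fin n → ℂ) :=
  {X | ∑ j, X j * dZ n (cR n ρ) j p = 0}

/-- Null space of the Levi form inside T^{1,0}_p(∂Ω). -/
def nullSp (n : ℕ) (ρ : Pt n → ℝ) (p : Pt n) : Set (Fin n → ℂ) :=
  {X | X ∈ T10 n ρ p ∧ ∀ Y ∈ T10 n ρ p, levi n ρ p X Y = 0}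

/-- ρ is a C^s defining function of Ω on the neighborhood V of the closure of Ω. -/
def IsDefining (n : ℕ) (s : ℕ∞) (Ω : Set (Pt n)) (ρ : Pt n → ℝ) (V : Set (Pt n)) : Prop :=
  IsOpen V ∧ closure Ω ⊆ V ∧ ContDiffOn ℝ s ρ V ∧
    Ω = {z | z ∈ V ∧ ρ z < 0} ∧ ∀ z ∈ frontier Ω, fderiv ℝ ρ z ≠ 0

/-- Strict plurisubharmonicity on a set, via positivity of the Levi form. -/
def StrictPSHOn (n : ℕ) (f : Pt n → ℝ) (s : Set (Pt n)) : Prop :=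
  ∀ z ∈ s, ∀ X : Fin n → ℂ, X ≠ 0 → 0 < (levi n f z X X).re

/-- Diederich–Fornaess exponent of a defining function ρ (0 if the defining set is empty). -/
def DFexp (n : ℕ) (ρ : Pt n → ℝ) (Ω : Set (Pt n)) : ℝ :=
  sSup {η : ℝ | 0 < η ∧ η < 1 ∧ StrictPSHOn n (fun z => -((-ρ z) ^ η)) Ω}

/-- Diederich–Fornaess index of Ω: supremum over all (C¹) defining functions. -/
def DFindex (n : ℕ) (Ω : Set (Pt n)) : ℝ :=
  sSup {e : ℝ | ∃ ρ V, IsDefining n 1 Ω ρ V ∧ e = DFexp n ρ Ω}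

/-- Steinness exponent of a defining function ρ (⊤ = ∞ if the defining set is empty). -/
def Sexp (n : ℕ) (ρ : Pt n → ℝ) (Ω : Set (Pt n)) : EReal :=
  sInf {e : EReal | ∃ η : ℝ, 1 < η ∧
    (∃ U : Set (Pt n), IsOpen U ∧ frontier Ω ⊆ U ∧
      StrictPSHOn n (fun z => ρ z ^ η) ((closure Ω)ᶜ ∩ U)) ∧ e = (η : EReal)}

/-- Steinness index of Ω: infimum over all (C¹) defining functions. -/
def Sindex (n : ℕ) (Ω : Set (Pt n)) : EReal :=
  sInf {e : EReal | ∃ ρ V, IsDefining n 1 Ω ρ V ∧ e = Sexp n ρ Ω}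

/-- A complex vector field Σ_j a_j ∂/∂z_j + Σ_j b_j ∂/∂z̄_j on ℂⁿ, recorded by its
coefficient functions. -/
structure VF (n : ℕ) where
  a : Pt n → Fin n → ℂ
  b : Pt n → Fin n → ℂ

/-- Action of a complex vector field on a function. -/
def VF.app {n : ℕ} (V : VF n) (f : Pt n → ℂ) (z : Pt n) : ℂ :=
  ∑ j, V.a z j * dZ n f j z + ∑ j, V.b z j * dZb n f j z

/-- The value of a vector field at a point, as a pair ((1,0)-part, (0,1)-part). -/
def VF.atPt {n : ℕ} (V : VF n) (p : Pt n) : (Fin n → ℂ) × (Fin n → ℂ) := (V.a p, V.b p)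

/-- A complex 1-form Σ_j w_j dz_j + Σ_j t_j dz̄_j on ℂⁿ. -/
structure Form1 (n : ℕ) where
  w : Pt n → Fin n → ℂ
  t : Pt n → Fin n → ℂ

/-- Value of a 1-form at a point on a complex tangent vector (pair of (1,0) and (0,1) parts). -/
def Form1.eval {n : ℕ} (η : Form1 n) (z : Pt n) (X : (Fin n → ℂ) × (Fin n → ℂ)) : ℂ :=
  ∑ j, η.w z j * X.1 j + ∑ j, η.t z j * X.2 j

/-- Pairing of a 1-form with a vector field. -/
def Form1.app {n : ℕ} (η : Form1 n) (V : VF n) (z : Pt n) : ℂ :=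
  η.eval z (V.atPt z)

/-- Lie bracket of complex vector fields. -/
def VF.bracket {n : ℕ} (V W : VF n) : VF n :=
  ⟨fun z j => V.app (fun w => W.a w j) z - W.app (fun w => V.a w j) z,
   fun z j => V.app (fun w => W.b w j) z - W.app (fun w => V.b w j) z⟩

/-- Levi-Civita covariant derivative ∇_V W of the Euclidean metric (componentwise derivative). -/
def covD {n : ℕ} (V W : VF n) : VF n :=
  ⟨fun z j => V.app (fun w => W.a w j) z, fun z j => V.app (fun w => W.b w j) z⟩

/-- Lie derivative of a 1-form along a vector field, in coordinates. -/
def lieD {n : ℕ} (T : VF n) (η : Form1 n) : Form1 n :=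
  ⟨fun z j => T.app (fun w => η.w w j) z + ∑ m, η.w z m * dZ n (fun w => T.a w m) j z
      + ∑ m, η.t z m * dZ n (fun w => T.b w m) j z,
   fun z j => T.app (fun w => η.t w j) z + ∑ m, η.w z m * dZb n (fun w => T.a w m) j z
      + ∑ m, η.t z m * dZb n (fun w => T.b w m) j z⟩

/-- Negation of a 1-form. -/
def Form1.neg {n : ℕ} (η : Form1 n) : Form1 n := ⟨fun z j => -η.w z j, fun z j => -η.t z j⟩

/-- Σ_j |∂ρ/∂z_j|². -/
def gradSq (n : ℕ) (ρ : Pt n → ℝ) (z : Pt n) : ℝ :=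
  ∑ j, Complex.normSq (dZ n (cR n ρ) j z)

/-- Norm of the real gradient of ρ: ‖∇ρ‖ = 2 (Σ_j |∂ρ/∂z_j|²)^{1/2}. -/
def gradNorm (n : ℕ) (ρ : Pt n → ℝ) (z : Pt n) : ℝ := 2 * Real.sqrt (gradSq n ρ z)

/-- The (1,0) field L_n = (Σ|∂ρ/∂z_j|²)⁻¹ Σ_j (∂ρ/∂z̄_j) ∂/∂z_j. -/
def LnVF (n : ℕ) (ρ : Pt n → ℝ) : VF n :=
  ⟨fun z j => dZb n (cR n ρ) j z / (gradSq n ρ z : ℂ), fun _ _ => 0⟩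

/-- The (1,0) field N = (Σ|∂ρ/∂z_j|²)^{-1/2} Σ_j (∂ρ/∂z̄_j) ∂/∂z_j. -/
def NVF (n : ℕ) (ρ : Pt n → ℝ) : VF n :=
  ⟨fun z j => dZb n (cR n ρ) j z / ((Real.sqrt (gradSq n ρ z) : ℝ) : ℂ), fun _ _ => 0⟩

/-- T = L_n − conj(L_n). -/
def TVF (n : ℕ) (ρ : Pt n → ℝ) : VF n :=
  ⟨fun z j => (LnVF n ρ).a z j, fun z j => -(starRingEnd ℂ) ((LnVF n ρ).a z j)⟩

/-- η = (1/2)(∂ρ − ∂̄ρ). -/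
def etaF (n : ℕ) (ρ : Pt n → ℝ) : Form1 n :=
  ⟨fun z j => (1 / 2 : ℂ) * dZ n (cR n ρ) j z,
   fun z j => -(1 / 2 : ℂ) * dZb n (cR n ρ) j z⟩

/-- The D'Angelo 1-form α_ρ = −Lie_T η of a defining function ρ. -/
def dAngelo (n : ℕ) (ρ : Pt n → ℝ) : Form1 n := Form1.neg (lieD (TVF n ρ) (etaF n ρ))

/-- Evaluation of the (1,0)-part ∂η of the exterior derivative of a 1-form on two
complex tangent vectors. -/
def delEval {n : ℕ} (η : Form1 n) (X Y : (Fin n → ℂ) × (Fin n → ℂ)) (z : Pt n) : ℂ :=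
  (∑ m, ∑ l, dZ n (fun w => η.w w l) m z * (X.1 m * Y.1 l - Y.1 m * X.1 l)) +
  (∑ m, ∑ l, dZ n (fun w => η.t w l) m z * (X.1 m * Y.2 l - Y.1 m * X.2 l))

/-- Evaluation of ∂̄η of a 1-form η on two complex tangent vectors. -/
def delbEval {n : ℕ} (η : Form1 n) (X Y : (Fin n → ℂ) × (Fin n → ℂ)) (z : Pt n) : ℂ :=
  (∑ m, ∑ l, dZb n (fun w => η.w w l) m z * (X.2 m * Y.1 l - Y.2 m * X.1 l)) +
  (∑ m, ∑ l, dZb n (fun w => η.t w l) m z * (X.2 m * Y.2 l - Y.2 m * X.2 l))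

/-- Evaluation of dη = ∂η + ∂̄η. -/
def dEval {n : ℕ} (η : Form1 n) (X Y : (Fin n → ℂ) × (Fin n → ℂ)) (z : Pt n) : ℂ :=
  delEval η X Y z + delbEval η X Y z

/-- Evaluation of d^c η = i(∂̄ − ∂)η. -/
def dcEval {n : ℕ} (η : Form1 n) (X Y : (Fin n → ℂ) × (Fin n → ℂ)) (z : Pt n) : ℂ :=
  Complex.I * (delbEval η X Y z - delEval η X Y z)

/-- Evaluation of ω ∧ ω̄ on two complex tangent vectors, where ω = π_{1,0} η is the
(1,0)-component of the real 1-form η. -/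
def omegaWedge {n : ℕ} (η : Form1 n) (X Y : (Fin n → ℂ) × (Fin n → ℂ)) (z : Pt n) : ℂ :=
  (∑ j, η.w z j * X.1 j) * (∑ j, (starRingEnd ℂ) (η.w z j) * Y.2 j) -
  (∑ j, η.w z j * Y.1 j) * (∑ j, (starRingEnd ℂ) (η.w z j) * X.2 j)

/-- Evaluation of ∂̄ω where ω = π_{1,0} η. -/
def delbOmega {n : ℕ} (η : Form1 n) (X Y : (Fin n → ℂ) × (Fin n → ℂ)) (z : Pt n) : ℂ :=
  delbEval ⟨η.w, fun _ _ => 0⟩ X Y z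

/-- The standard Euclidean complex Hermitian metric g on complexified tangent vectors
(so that g(∂/∂z_j, ∂/∂z_j) = 1/2). -/
def gMet {n : ℕ} (X Y : (Fin n → ℂ) × (Fin n → ℂ)) : ℂ :=
  (1 / 2 : ℂ) * (∑ j, X.1 j * (starRingEnd ℂ) (Y.1 j) + ∑ j, X.2 j * (starRingEnd ℂ) (Y.2 j))

/-- The real gradient ∇ρ as a complex vector field: 2Σ_j (∂ρ/∂z̄_j ∂/∂z_j + ∂ρ/∂z_j ∂/∂z̄_j). -/
def gradVF (n : ℕ) (ρ : Pt n → ℝ) : VF n :=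
  ⟨fun z j => 2 * dZb n (cR n ρ) j z, fun z j => 2 * dZ n (cR n ρ) j z⟩

/-- Pseudoconvexity of Ω (w.r.t. the defining function ρ): the Levi form is positive
semidefinite on the holomorphic tangent spaces of the boundary. -/
def LeviPseudoconvex (n : ℕ) (ρ : Pt n → ℝ) (Ω : Set (Pt n)) : Prop :=
  ∀ p ∈ frontier Ω, ∀ X ∈ T10 n ρ p, 0 ≤ (levi n ρ p X X).re

/-- The set Σ of weakly pseudoconvex boundary points. -/
def weakPts (n : ℕ) (ρ : Pt n → ℝ) (Ω : Set (Pt n)) : Set (Pt n) :=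
  {p | p ∈ frontier Ω ∧ ∃ X ∈ T10 n ρ p, X ≠ 0 ∧ levi n ρ p X X = 0}

/-- Action of a complex tangent vector at p on a function. -/
def vecApp (n : ℕ) (X : (Fin n → ℂ) × (Fin n → ℂ)) (f : Pt n → ℂ) (p : Pt n) : ℂ :=
  ∑ j, X.1 j * dZ n f j p + ∑ j, X.2 j * dZb n f j p

/-- Pushforward (complexified differential) of a complex tangent vector at p by a map f. -/
def push (n : ℕ) (f : Pt n → Pt n) (p : Pt n) (X : (Fin n → ℂ) × (Fin n → ℂ)) :
    (Fin n → ℂ) × (Fin n → ℂ) :=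
  (fun l => vecApp n X (fun w => f w l) p,
   fun l => vecApp n X (fun w => (starRingEnd ℂ) (f w l)) p)

/-- Conjugation of a coefficient tuple. -/
def conjVec {n : ℕ} (X : Fin n → ℂ) : Fin n → ℂ := fun j => (starRingEnd ℂ) (X j)

/-- A C^k CR-diffeomorphism between ∂Ω₁ and ∂Ω₂, presented by a C^k map f on a
neighborhood U₁ of ∂Ω₁ together with a C^k local inverse g: f maps ∂Ω₁ onto ∂Ω₂
diffeomorphically and its differential maps T^{1,0}(∂Ω₁) into T^{1,0}(∂Ω₂). -/
def IsCRDiffeo (n : ℕ) (k : ℕ∞) (Ω₁ Ω₂ : Set (Pt n)) (ρ₁ ρ₂ : Pt n → ℝ)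
    (f g : Pt n → Pt n) (U₁ U₂ : Set (Pt n)) : Prop :=
  IsOpen U₁ ∧ IsOpen U₂ ∧ frontier Ω₁ ⊆ U₁ ∧ frontier Ω₂ ⊆ U₂ ∧
  (∀ l, ContDiffOn ℝ k (fun z => f z l) U₁) ∧
  (∀ l, ContDiffOn ℝ k (fun z => g z l) U₂) ∧
  f '' frontier Ω₁ = frontier Ω₂ ∧
  (∀ p ∈ frontier Ω₁, g (f p) = p) ∧ (∀ q ∈ frontier Ω₂, f (g q) = q) ∧
  (∀ p ∈ frontier Ω₁, ∀ L ∈ T10 n ρ₁ p,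
    (push n f p (L, 0)).2 = 0 ∧ (push n f p (L, 0)).1 ∈ T10 n ρ₂ (f p))

/-- The 1-form d^c ψ = i(∂̄ψ − ∂ψ) of a real function ψ. -/
def dcForm (n : ℕ) (ψ : Pt n → ℝ) : Form1 n :=
  ⟨fun z j => -Complex.I * dZ n (cR n ψ) j z, fun z j => Complex.I * dZb n (cR n ψ) j z⟩

end

/-- The pairing ∂ρ(Z) = Σ_j (∂ρ/∂z_j) Z_j of the (1,0)-form ∂ρ with (the (1,0)-part of)
a complex vector field Z. -/
noncomputable def delPair (n : ℕ) (ρ : Pt n → ℝ) (Z : VF n) (p : Pt n) : ℂ :=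
  ∑ j, dZ n (cR n ρ) j p * Z.a p j

section Wirtinger

variable {n : ℕ}

theorem dZ_const (c : ℂ) (j : Fin n) (z : Pt n) : dZ n (fun _ => c) j z = 0 := by
  simp [dZ]

theorem dZb_const (c : ℂ) (j : Fin n) (z : Pt n) : dZb n (fun _ => c) j z = 0 := by
  simp [dZb]

theorem dZ_const_mul {f : Pt n → ℂ} {z : Pt n} (hf : DifferentiableAt ℝ f z) (c : ℂ)
    (j : Fin n) : dZ n (fun w => c * f w) j z = c * dZ n f j z := by
  simp only [dZ, fderiv_const_mul hf, smul_apply, smul_eq_mul]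
  ring

theorem dZb_const_mul {f : Pt n → ℂ} {z : Pt n} (hf : DifferentiableAt ℝ f z) (c : ℂ)
    (j : Fin n) : dZb n (fun w => c * f w) j z = c * dZb n f j z := by
  simp only [dZb, fderiv_const_mul hf, smul_apply, smul_eq_mul]
  ring

theorem dZ_neg (f : Pt n → ℂ) (j : Fin n) (z : Pt n) :
    dZ n (fun w => -f w) j z = -dZ n f j z := by
  simp only [dZ, fderiv_fun_neg, neg_apply]
  ring

theorem dZb_neg (f : Pt n → ℂ) (j : Fin n) (z : Pt n) :
    dZb n (fun w => -f w) j z = -dZb n f j z := by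
  simp only [dZb, fderiv_fun_neg, neg_apply]
  ring

theorem dZb_congr {f g : Pt n → ℂ} {z : Pt n} (h : f =ᶠ[nhds z] g) (j : Fin n) :
    dZb n f j z = dZb n g j z := by
  simp only [dZb, h.fderiv_eq]

theorem dZb_mul {f g : Pt n → ℂ} {z : Pt n} (hf : DifferentiableAt ℝ f z)
    (hg : DifferentiableAt ℝ g z) (j : Fin n) :
    dZb n (fun w => f w * g w) j z = f z * dZb n g j z + g z * dZb n f j z := by
  simp only [dZb, fderiv_fun_mul hf hg, add_apply,
    smul_apply, smul_eq_mul]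
  ring

theorem dZb_sum {ι : Type*} (s : Finset ι) {f : ι → Pt n → ℂ} {z : Pt n}
    (hf : ∀ i ∈ s, DifferentiableAt ℝ (f i) z) (j : Fin n) :
    dZb n (fun w => ∑ i ∈ s, f i w) j z = ∑ i ∈ s, dZb n (f i) j z := by
  simp only [dZb, fderiv_fun_sum hf, sum_apply, Finset.mul_sum,
    ← Finset.sum_add_distrib]

/-- Leibniz rule for a pairing that is locally constant. -/
theorem sum_mul_dZb_eq_neg {ι : Type*} [Fintype ι] {f g : ι → Pt n → ℂ} {z : Pt n} {c : ℂ}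
    (hf : ∀ i, DifferentiableAt ℝ (f i) z) (hg : ∀ i, DifferentiableAt ℝ (g i) z)
    (h : (fun w => ∑ i, f i w * g i w) =ᶠ[nhds z] fun _ => c) (j : Fin n) :
    ∑ i, f i z * dZb n (g i) j z = -∑ i, g i z * dZb n (f i) j z := by
  have h0 := dZb_congr h j
  rw [dZb_const, dZb_sum _ fun i _ => (hf i).fun_mul (hg i)] at h0
  simp only [fun i => dZb_mul (hf i) (hg i) j, Finset.sum_add_distrib] at h0
  exact eq_neg_of_add_eq_zero_left h0

theorem ContDiffAt.differentiableAt_fderiv_apply {f : Pt n → ℂ} {z : Pt n}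
    (hf : ContDiffAt ℝ 2 f z) (v : Pt n) : DifferentiableAt ℝ (fun w => fderiv ℝ f w v) z :=
  ((hf.fderiv_right (m := 1) le_rfl).differentiableAt one_ne_zero).clm_apply
    (differentiableAt_const v)

theorem ContDiffAt.differentiableAt_dZ {f : Pt n → ℂ} {z : Pt n} (hf : ContDiffAt ℝ 2 f z)
    (j : Fin n) : DifferentiableAt ℝ (dZ n f j) z :=
  ((hf.differentiableAt_fderiv_apply _).sub
    ((hf.differentiableAt_fderiv_apply _).const_mul _)).const_mul _

theorem ContDiffAt.differentiableAt_dZb {f : Pt n → ℂ} {z : Pt n} (hf : ContDiffAt ℝ 2 f z)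
    (j : Fin n) : DifferentiableAt ℝ (dZb n f j) z :=
  ((hf.differentiableAt_fderiv_apply _).add
    ((hf.differentiableAt_fderiv_apply _).const_mul _)).const_mul _

theorem ContDiffAt.fderiv_fderiv_apply {f : Pt n → ℂ} {z : Pt n} (hf : ContDiffAt ℝ 2 f z)
    (u v : Pt n) :
    fderiv ℝ (fun w => fderiv ℝ f w u) z v = fderiv ℝ (fderiv ℝ f) z v u := by
  rw [fderiv_clm_apply ((hf.fderiv_right (m := 1) le_rfl).differentiableAt one_ne_zero)
    (differentiableAt_const u)]
  simp

theorem ContDiffAt.fderiv_dZ_apply {f : Pt n → ℂ} {z : Pt n} (hf : ContDiffAt ℝ 2 f z)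
    (j : Fin n) (v : Pt n) :
    fderiv ℝ (dZ n f j) z v = (1 / 2 : ℂ) * (fderiv ℝ (fderiv ℝ f) z v (Pi.single j 1)
      - Complex.I * fderiv ℝ (fderiv ℝ f) z v (Pi.single j Complex.I)) := by
  have h := hf.differentiableAt_fderiv_apply
  unfold dZ
  rw [fderiv_const_mul ((h _).fun_sub ((h _).const_mul _)),
    fderiv_fun_sub (h _) ((h _).const_mul _), fderiv_const_mul (h _)]
  simp only [smul_apply, sub_apply, smul_eq_mul, hf.fderiv_fderiv_apply]

theorem ContDiffAt.fderiv_dZb_apply {f : Pt n → ℂ} {z : Pt n} (hf : ContDiffAt ℝ 2 f z)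
    (j : Fin n) (v : Pt n) :
    fderiv ℝ (dZb n f j) z v = (1 / 2 : ℂ) * (fderiv ℝ (fderiv ℝ f) z v (Pi.single j 1)
      + Complex.I * fderiv ℝ (fderiv ℝ f) z v (Pi.single j Complex.I)) := by
  have h := hf.differentiableAt_fderiv_apply
  unfold dZb
  rw [fderiv_const_mul ((h _).fun_add ((h _).const_mul _)),
    fderiv_fun_add (h _) ((h _).const_mul _), fderiv_const_mul (h _)]
  simp only [smul_apply, add_apply, smul_eq_mul, hf.fderiv_fderiv_apply]

theorem ContDiffAt.dZb_dZ_comm {f : Pt n → ℂ} {z : Pt n} (hf : ContDiffAt ℝ 2 f z)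
    (i j : Fin n) : dZb n (dZ n f i) j z = dZ n (dZb n f j) i z := by
  have hs : ∀ u v, fderiv ℝ (fderiv ℝ f) z u v = fderiv ℝ (fderiv ℝ f) z v u :=
    hf.isSymmSndFDerivAt (by simp)
  rw [dZ, dZb]
  simp only [hf.fderiv_dZ_apply, hf.fderiv_dZb_apply,
    hs (Pi.single j _) (Pi.single i _)]
  ring

theorem ContDiffAt.dZb_dZb_comm {f : Pt n → ℂ} {z : Pt n} (hf : ContDiffAt ℝ 2 f z)
    (i j : Fin n) : dZb n (dZb n f i) j z = dZb n (dZb n f j) i z := by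
  have hs : ∀ u v, fderiv ℝ (fderiv ℝ f) z u v = fderiv ℝ (fderiv ℝ f) z v u :=
    hf.isSymmSndFDerivAt (by simp)
  rw [dZb, dZb]
  simp only [hf.fderiv_dZb_apply, hs (Pi.single j _) (Pi.single i _)]
  ring

theorem fderiv_cR_apply {ρ : Pt n → ℝ} {z : Pt n} (hρ : DifferentiableAt ℝ ρ z) (v : Pt n) :
    fderiv ℝ (cR n ρ) z v = (fderiv ℝ ρ z v : ℂ) := by
  have h : HasFDerivAt (cR n ρ) (Complex.ofRealCLM.comp (fderiv ℝ ρ z)) z :=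
    Complex.ofRealCLM.hasFDerivAt.comp z hρ.hasFDerivAt
  rw [h.fderiv]
  rfl

theorem conj_dZ_cR {ρ : Pt n → ℝ} {z : Pt n} (hρ : DifferentiableAt ℝ ρ z) (j : Fin n) :
    (starRingEnd ℂ) (dZ n (cR n ρ) j z) = dZb n (cR n ρ) j z := by
  simp [dZ, dZb, fderiv_cR_apply hρ, Complex.conj_ofNat]

theorem ofReal_gradSq {ρ : Pt n → ℝ} {z : Pt n} (hρ : DifferentiableAt ℝ ρ z) :
    (gradSq n ρ z : ℂ) = ∑ j, dZ n (cR n ρ) j z * dZb n (cR n ρ) j z := by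
  simp only [gradSq, Complex.ofReal_sum, ← Complex.mul_conj, conj_dZ_cR hρ]

theorem gradSq_nonneg (ρ : Pt n → ℝ) (z : Pt n) : 0 ≤ gradSq n ρ z :=
  Finset.sum_nonneg fun _ _ => Complex.normSq_nonneg _

theorem gradSq_ne_zero {ρ : Pt n → ℝ} {z : Pt n} (hρ : fderiv ℝ ρ z ≠ 0) :
    gradSq n ρ z ≠ 0 := by
  intro h0
  have hd : DifferentiableAt ℝ ρ z := by
    by_contra h
    exact hρ (fderiv_zero_of_not_differentiableAt h)
  have hz : ∀ j, dZ n (cR n ρ) j z = 0 := fun j => Complex.normSq_eq_zero.1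
    ((Finset.sum_eq_zero_iff_of_nonneg fun _ _ => Complex.normSq_nonneg _).1 h0 j
      (Finset.mem_univ j))
  have hre : ∀ j, fderiv ℝ ρ z (Pi.single j 1) = 0 := fun j => by
    simpa [dZ, fderiv_cR_apply hd] using congrArg Complex.re (hz j)
  have him : ∀ j, fderiv ℝ ρ z (Pi.single j Complex.I) = 0 := fun j => by
    simpa [dZ, fderiv_cR_apply hd] using congrArg Complex.im (hz j)
  apply hρ
  ext v
  have hv : v = ∑ j, ((v j).re • (Pi.single j 1 : Pt n)
      + (v j).im • (Pi.single j Complex.I : Pt n)) := by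
    ext i
    simp [Finset.sum_apply, Pi.single_apply, Finset.sum_add_distrib, Complex.re_add_im]
  rw [hv]
  simp [hre, him]

end Wirtinger

section LnField

variable {n : ℕ} {ρ : Pt n → ℝ} {p : Pt n}

theorem contDiffAt_cR (hρ : ContDiffAt ℝ 2 ρ p) : ContDiffAt ℝ 2 (cR n ρ) p :=
  Complex.ofRealCLM.contDiff.contDiffAt.comp p hρ

theorem eventually_differentiableAt (hρ : ContDiffAt ℝ 2 ρ p) :
    ∀ᶠ z in nhds p, DifferentiableAt ℝ ρ z :=
  (hρ.eventually (by simp)).mono fun _ h => h.differentiableAt two_ne_zero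

theorem differentiableAt_ofReal_gradSq (hρ : ContDiffAt ℝ 2 ρ p) :
    DifferentiableAt ℝ (fun z => (gradSq n ρ z : ℂ)) p := by
  have h : DifferentiableAt ℝ
      (fun z => ∑ j, dZ n (cR n ρ) j z * dZb n (cR n ρ) j z) p :=
    DifferentiableAt.fun_sum fun j _ =>
      ((contDiffAt_cR hρ).differentiableAt_dZ j).mul ((contDiffAt_cR hρ).differentiableAt_dZb j)
  exact h.congr_of_eventuallyEq
    ((eventually_differentiableAt hρ).mono fun _ hz => ofReal_gradSq hz)

theorem differentiableAt_LnVF (hρ : ContDiffAt ℝ 2 ρ p) (hd : fderiv ℝ ρ p ≠ 0) (j : Fin n) :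
    DifferentiableAt ℝ (fun z => (LnVF n ρ).a z j) p := by
  have h := ((contDiffAt_cR hρ).differentiableAt_dZb j).mul
    ((differentiableAt_ofReal_gradSq hρ).inv
    (Complex.ofReal_ne_zero.2 (gradSq_ne_zero hd)))
  exact h

theorem differentiableAt_conj_LnVF (hρ : ContDiffAt ℝ 2 ρ p) (hd : fderiv ℝ ρ p ≠ 0)
    (j : Fin n) : DifferentiableAt ℝ (fun z => (starRingEnd ℂ) ((LnVF n ρ).a z j)) p :=
  Complex.conjCLE.differentiableAt.comp p (differentiableAt_LnVF hρ hd j)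

/-- `∂ρ(L_n) = 1` near a point where `dρ ≠ 0`. -/
theorem sum_dZ_mul_LnVF (hρ : ContDiffAt ℝ 2 ρ p) (hd : fderiv ℝ ρ p ≠ 0) :
    (fun z => ∑ j, dZ n (cR n ρ) j z * (LnVF n ρ).a z j) =ᶠ[nhds p] fun _ => 1 := by
  filter_upwards [eventually_differentiableAt hρ,
    (differentiableAt_ofReal_gradSq hρ).continuousAt.eventually_ne
      (Complex.ofReal_ne_zero.2 (gradSq_ne_zero hd))] with z hz hG
  simp only [LnVF, mul_div_assoc', ← Finset.sum_div, ← ofReal_gradSq hz, div_self hG]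

/-- `∂̄ρ(L̄_n) = 1` near a point where `dρ ≠ 0`. -/
theorem sum_dZb_mul_conj_LnVF (hρ : ContDiffAt ℝ 2 ρ p) (hd : fderiv ℝ ρ p ≠ 0) :
    (fun z => ∑ j, dZb n (cR n ρ) j z * (starRingEnd ℂ) ((LnVF n ρ).a z j))
      =ᶠ[nhds p] fun _ => 1 := by
  filter_upwards [eventually_differentiableAt hρ, sum_dZ_mul_LnVF hρ hd] with z hz h1
  simpa [conj_dZ_cR hz] using congrArg (starRingEnd ℂ) h1

/-- The (0,1)-part of the D'Angelo form is the contraction of the Levi form with `L_n`. -/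
theorem dAngelo_t (hρ : ContDiffAt ℝ 2 ρ p) (hd : fderiv ℝ ρ p ≠ 0) (j : Fin n) :
    (dAngelo n ρ).t p j = ∑ i, dZ n (dZb n (cR n ρ) j) i p * (LnVF n ρ).a p i := by
  have hr := (contDiffAt_cR hρ).differentiableAt_dZ
  have hrb := (contDiffAt_cR hρ).differentiableAt_dZb
  have h1 := sum_mul_dZb_eq_neg hr (differentiableAt_LnVF hρ hd) (sum_dZ_mul_LnVF hρ hd) j
  have h2 := sum_mul_dZb_eq_neg hrb (differentiableAt_conj_LnVF hρ hd)
    (sum_dZb_mul_conj_LnVF hρ hd) j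
  simp only [(contDiffAt_cR hρ).dZb_dZ_comm, (contDiffAt_cR hρ).dZb_dZb_comm _ j] at h1 h2
  simp only [dAngelo, Form1.neg, lieD, etaF, TVF, VF.app, dZ_const_mul (hrb _),
    dZb_const_mul (hrb _), dZ_neg, dZb_neg, mul_neg, neg_mul, neg_neg, mul_assoc, Finset.sum_neg_distrib,
    ← Finset.mul_sum, mul_left_comm _ (1 / 2 : ℂ), h1, h2,
    mul_comm (dZ n (dZb n (cR n ρ) j) _ p)]
  ring

theorem dAngelo_eval_conj (hρ : ContDiffAt ℝ 2 ρ p) (hd : fderiv ℝ ρ p ≠ 0) (X : Fin n → ℂ) :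
    Form1.eval (dAngelo n ρ) p (0, conjVec X) = levi n ρ p ((LnVF n ρ).a p) X := by
  simp only [Form1.eval, Pi.zero_apply, mul_zero, Finset.sum_const_zero, zero_add, levi,
    dAngelo_t hρ hd, conjVec, Finset.sum_mul]
  exact Finset.sum_comm

theorem delPair_bracket_LnVF_conj (hρ : ContDiffAt ℝ 2 ρ p) (hd : fderiv ℝ ρ p ≠ 0)
    (a : Pt n → Fin n → ℂ) :
    delPair n ρ
        (VF.bracket (LnVF n ρ) ⟨fun _ _ => 0, fun z j => (starRingEnd ℂ) (a z j)⟩) p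
      = levi n ρ p ((LnVF n ρ).a p) (a p) := by
  have h1 := sum_mul_dZb_eq_neg (contDiffAt_cR hρ).differentiableAt_dZ (differentiableAt_LnVF hρ hd)
    (sum_dZ_mul_LnVF hρ hd)
  simp only [(contDiffAt_cR hρ).dZb_dZ_comm] at h1
  simp only [delPair, VF.bracket, VF.app, dZ_const, dZb_const, mul_zero, zero_mul,
    Finset.sum_const_zero, zero_add, zero_sub, mul_neg, Finset.sum_neg_distrib, Finset.mul_sum,
    levi]
  rw [Finset.sum_comm, Finset.sum_comm (s := Finset.univ (α := Fin n)) (t := Finset.univ)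
    (f := fun j k => dZ n (dZb n (cR n ρ) k) j p * (LnVF n ρ).a p j *
      (starRingEnd ℂ) (a p k)), ← Finset.sum_neg_distrib]
  refine Finset.sum_congr rfl fun i _ => ?_
  simp only [mul_left_comm _ ((starRingEnd ℂ) (a p i)), ← Finset.mul_sum, h1, ← Finset.sum_mul,
    mul_comm (dZ n (dZb n (cR n ρ) i) _ p)]
  ring

theorem levi_NVF_div_gradNorm (X : Fin n → ℂ) :
    2 * levi n ρ p ((NVF n ρ).a p) X / (gradNorm n ρ p : ℂ)
      = levi n ρ p ((LnVF n ρ).a p) X := by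
  have hs : (gradSq n ρ p : ℂ) = (Real.sqrt (gradSq n ρ p) : ℂ) * Real.sqrt (gradSq n ρ p) := by
    rw [← Complex.ofReal_mul, Real.mul_self_sqrt (gradSq_nonneg ρ p)]
  simp only [levi, NVF, LnVF, gradNorm, Complex.ofReal_mul, Complex.ofReal_ofNat,
    mul_div_mul_left _ _ (two_ne_zero' ℂ), Finset.sum_div]
  refine Finset.sum_congr rfl fun j _ => Finset.sum_congr rfl fun k _ => ?_
  rw [hs, div_mul_eq_div_div]
  ring

end LnField

/-- Lemma 3.4, Boas–Straube: for the D'Angelo 1-form α = α_ρ and any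
smooth (1,0) tangent field L on ∂Ω, α(L̄) = ∂ρ([L_n, L̄]) = 2 Levi_ρ(N, L)/‖∇ρ‖ on ∂Ω. -/
theorem dAngelo_eval_conj_tangent
    (n k : ℕ) (hn : 2 ≤ n) (hk : 3 ≤ k)
    (Ω : Set (Pt n)) (hopen : IsOpen Ω) (hconn : IsConnected Ω)
    (hbdd : Bornology.IsBounded Ω)
    (ρ : Pt n → ℝ) (V : Set (Pt n)) (hdef : IsDefining n (k : ℕ∞) Ω ρ V)
    (hpsc : LeviPseudoconvex n ρ Ω)
    (U : Set (Pt n)) (hU : IsOpen U) (hUfr : frontier Ω ⊆ U)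
    (a : Pt n → Fin n → ℂ)
    (hsm : ∀ j, ContDiffOn ℝ (⊤ : ℕ∞) (fun w => a w j) U)
    (htan : ∀ z ∈ frontier Ω, ∑ j, a z j * dZ n (cR n ρ) j z = 0)
    (p : Pt n) (hp : p ∈ frontier Ω) :
    Form1.eval (dAngelo n ρ) p (0, conjVec (a p))
      = delPair n ρ
          (VF.bracket (LnVF n ρ) ⟨fun _ _ => 0, fun z j => (starRingEnd ℂ) (a z j)⟩) p ∧
    delPair n ρ
        (VF.bracket (LnVF n ρ) ⟨fun _ _ => 0, fun z j => (starRingEnd ℂ) (a z j)⟩) p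
      = 2 * levi n ρ p ((NVF n ρ).a p) (a p) / (gradNorm n ρ p : ℂ) := by
  have hpV : p ∈ V := hdef.2.1 (frontier_subset_closure hp)
  have hk2 : (2 : ℕ∞) ≤ k := by exact_mod_cast (show 2 ≤ k by omega)
  have hρ : ContDiffAt ℝ 2 ρ p :=
    (hdef.2.2.1.contDiffAt (hdef.1.mem_nhds hpV)).of_le (WithTop.coe_le_coe.2 hk2)
  have hd : fderiv ℝ ρ p ≠ 0 := hdef.2.2.2.2 p hp
  rw [dAngelo_eval_conj hρ hd, delPair_bracket_LnVF_conj hρ hd, levi_NVF_div_gradNorm]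
  exact ⟨rfl, rfl⟩
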